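/- arXiv:1501.00965 — 3 statements merged into one kernel-verified Lean document; each statement's English description precedes it below -/
import Mathlib

section
/- For every integer m ≥ 2, every positive integer N, and every continuous m-linear form U : (ℝ^N)^m → ℝ (where ℝ^N carries the sup norm), one has Σ_{j₁=1}^{N} ( Σ_{j₂,...,j_m=1}^{N} |U(e_{j₁},...,e_{j_m})|² )^{1/2} ≤ (√2)^{m-1} · ‖U‖. -/
/-- Average over the cube `{±1}^n`, as a linear functional. -/
noncomputable def cubeE : (n : ℕ) → ((Fin n → ℝ) → ℝ) →ₗ[ℝ] ℝ
  | 0 => LinearMap.proj (fun _ => 0)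
  | n + 1 => (1 / 2 : ℝ) • ((cubeE n).comp (LinearMap.funLeft ℝ ℝ (fun x => Fin.cons 1 x))
      + (cubeE n).comp (LinearMap.funLeft ℝ ℝ (fun x => Fin.cons (-1) x)))

theorem cubeE_zero (g : (Fin 0 → ℝ) → ℝ) : cubeE 0 g = g (fun _ => 0) := rfl

theorem cubeE_succ (n : ℕ) (g : (Fin (n + 1) → ℝ) → ℝ) :
    cubeE (n + 1) g = 1 / 2 * (cubeE n (fun x => g (Fin.cons 1 x))
      + cubeE n (fun x => g (Fin.cons (-1) x))) := rfl

theorem cubeE_const (n : ℕ) (c : ℝ) : cubeE n (fun _ => c) = c := by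
  induction n with
  | zero => rfl
  | succ n ih => rw [cubeE_succ, ih]; ring

theorem cubeE_mono (n : ℕ) (f g : (Fin n → ℝ) → ℝ)
    (h : ∀ x, (∀ i, |x i| ≤ 1) → f x ≤ g x) : cubeE n f ≤ cubeE n g := by
  induction n with
  | zero => exact h _ (fun i => i.elim0)
  | succ n ih =>
    rw [cubeE_succ, cubeE_succ]
    have h1 := ih (fun x => f (Fin.cons 1 x)) (fun x => g (Fin.cons 1 x)) (fun x hx => h _ (by
      intro i; refine Fin.cases ?_ (fun i => ?_) i <;> simp [hx]))
    have h2 := ih (fun x => f (Fin.cons (-1) x)) (fun x => g (Fin.cons (-1) x)) (fun x hx => h _ (by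
      intro i; refine Fin.cases ?_ (fun i => ?_) i <;> simp [hx]))
    linarith

theorem neg_cons (n : ℕ) (a : ℝ) (x : Fin n → ℝ) :
    -(Fin.cons a x : Fin (n + 1) → ℝ) = Fin.cons (-a) (-x) := by
  ext i; refine Fin.cases ?_ (fun i => ?_) i <;> simp

theorem cubeE_neg (n : ℕ) (g : (Fin n → ℝ) → ℝ) : cubeE n (fun x => g (-x)) = cubeE n g := by
  induction n with
  | zero => rw [cubeE_zero, cubeE_zero]; congr 1; ext i; exact i.elim0
  | succ n ih =>
    rw [cubeE_succ, cubeE_succ]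
    simp only [neg_cons, neg_neg]
    rw [ih (fun x => g (Fin.cons (-1) x)), ih (fun x => g (Fin.cons 1 x))]
    ring

/-- Flip of a coordinate. -/
def cflip {n : ℕ} (i : Fin n) (x : Fin n → ℝ) : Fin n → ℝ := Function.update x i (-x i)

theorem cflip_zero (n : ℕ) (a : ℝ) (x : Fin n → ℝ) :
    cflip 0 (Fin.cons a x : Fin (n + 1) → ℝ) = Fin.cons (-a) x := by
  simp [cflip]

theorem cflip_succ (n : ℕ) (a : ℝ) (i : Fin n) (x : Fin n → ℝ) :
    cflip i.succ (Fin.cons a x : Fin (n + 1) → ℝ) = Fin.cons a (cflip i x) := by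
  simp [cflip, Fin.cons_update]

theorem cubeE_flip (n : ℕ) (i : Fin n) (g : (Fin n → ℝ) → ℝ) :
    cubeE n (fun x => g (cflip i x)) = cubeE n g := by
  induction n with
  | zero => exact i.elim0
  | succ n ih =>
    rw [cubeE_succ, cubeE_succ]
    refine Fin.cases ?_ (fun i => ?_) i
    · simp only [cflip_zero, neg_neg]; ring
    · simp only [cflip_succ]
      rw [ih i (fun x => g (Fin.cons (-1) x)), ih i (fun x => g (Fin.cons 1 x))]

/-- Twice the Dirichlet form. -/
noncomputable def cQ (n : ℕ) (g : (Fin n → ℝ) → ℝ) : ℝ :=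
  ∑ i, cubeE n (fun x => g x ^ 2 - g x * g (cflip i x))

theorem cQ_nonneg (n : ℕ) (g : (Fin n → ℝ) → ℝ) : 0 ≤ cQ n g := by
  refine Finset.sum_nonneg (fun i _ => ?_)
  have h1 := cubeE_flip n i (fun x => g x ^ 2)
  have h2 : 0 ≤ cubeE n (fun x => (g x - g (cflip i x)) ^ 2) := by
    rw [← cubeE_const n 0]; exact cubeE_mono _ _ _ (fun x _ => sq_nonneg _)
  have h3 : (fun x => (g x - g (cflip i x)) ^ 2) = (2 : ℝ) • (fun x => g x ^ 2 - g x * g (cflip i x))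
      + ((fun x => g (cflip i x) ^ 2) - (fun x => g x ^ 2)) := by
    ext x; simp; ring
  rw [h3, map_add, map_smul, map_sub, h1, smul_eq_mul] at h2
  linarith

theorem cN_le (n : ℕ) (g : (Fin n → ℝ) → ℝ) :
    cubeE n (fun x => g x * g (-x)) ≤ cubeE n (fun x => g x ^ 2) := by
  have h1 := cubeE_neg n (fun x => g x ^ 2)
  have h2 : 0 ≤ cubeE n (fun x => (g x - g (-x)) ^ 2) := by
    rw [← cubeE_const n 0]; exact cubeE_mono _ _ _ (fun x _ => sq_nonneg _)
  have h3 : (fun x => (g x - g (-x)) ^ 2) = (fun x => g x ^ 2) + (fun x => g (-x) ^ 2)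
      - (2 : ℝ) • (fun x => g x * g (-x)) := by
    ext x; simp; ring
  rw [h3, map_sub, map_smul, map_add, h1, smul_eq_mul] at h2
  linarith

section
variable {n : ℕ} (g : (Fin (n + 1) → ℝ) → ℝ)

/-- Even part in the first coordinate. -/
noncomputable def cU (x : Fin n → ℝ) : ℝ := 1 / 2 * (g (Fin.cons 1 x) + g (Fin.cons (-1) x))
/-- Odd part in the first coordinate. -/
noncomputable def cV (x : Fin n → ℝ) : ℝ := 1 / 2 * (g (Fin.cons 1 x) - g (Fin.cons (-1) x))

theorem cE_split : cubeE (n + 1) g = cubeE n (cU g) := by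
  rw [cubeE_succ, ← map_add, ← smul_eq_mul, ← map_smul]
  rfl

theorem cSq_split : cubeE (n + 1) (fun x => g x ^ 2)
    = cubeE n (fun x => cU g x ^ 2) + cubeE n (fun x => cV g x ^ 2) := by
  rw [cE_split, ← map_add]; congr 1; ext x; simp [cU, cV]; ring

theorem cN_split : cubeE (n + 1) (fun x => g x * g (-x))
    = cubeE n (fun x => cU g x * cU g (-x)) - cubeE n (fun x => cV g x * cV g (-x)) := by
  rw [cE_split, ← map_sub]; congr 1; ext x; simp [cU, cV, neg_cons]; ring

theorem cQ_split : cQ (n + 1) g = cQ n (cU g) + cQ n (cV g) + 2 * cubeE n (fun x => cV g x ^ 2) := by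
  unfold cQ
  rw [Fin.sum_univ_succ, ← Finset.sum_add_distrib, add_comm]
  congr 1
  · refine Finset.sum_congr rfl (fun i _ => ?_)
    rw [cE_split, ← map_add]; congr 1; ext x; simp [cU, cV, cflip_succ]; ring
  · rw [cE_split, ← smul_eq_mul, ← map_smul]; congr 1; ext x; simp [cU, cV, cflip_zero]; ring
end

theorem cube_C (n : ℕ) (g : (Fin n → ℝ) → ℝ) :
    cubeE n (fun x => g x ^ 2) - cubeE n (fun x => g x * g (-x)) ≤ cQ n g := by
  induction n with
  | zero =>
    simp only [cubeE_zero, cQ, Finset.univ_eq_empty, Finset.sum_empty]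
    rw [show (-(fun _ => 0) : Fin 0 → ℝ) = (fun _ => 0) from by ext i; exact i.elim0]
    linarith
  | succ n ih =>
    rw [cSq_split, cN_split, cQ_split]
    linarith [ih (cU g), cN_le n (cV g), cQ_nonneg n (cV g)]

theorem cube_B (n : ℕ) (g : (Fin n → ℝ) → ℝ) :
    cubeE n (fun x => g x ^ 2) - (cubeE n g) ^ 2 ≤ 1 / 4 * cQ n g +
      1 / 4 * (cubeE n (fun x => g x ^ 2) - cubeE n (fun x => g x * g (-x))) := by
  induction n with
  | zero =>
    simp only [cubeE_zero, cQ, Finset.univ_eq_empty, Finset.sum_empty]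
    rw [show (-(fun _ => 0) : Fin 0 → ℝ) = (fun _ => 0) from by ext i; exact i.elim0]
    linarith
  | succ n ih =>
    rw [cSq_split, cN_split, cQ_split, cE_split]
    linarith [ih (cU g), cube_C n (cV g)]

theorem cube_norm_sq {H : Type*} [NormedAddCommGroup H] [InnerProductSpace ℝ H] (n : ℕ)
    (w : H) (v : Fin n → H) :
    cubeE n (fun x => ‖w + ∑ i, x i • v i‖ ^ 2) = ‖w‖ ^ 2 + ∑ i, ‖v i‖ ^ 2 := by
  induction n generalizing w with
  | zero => simp [cubeE_zero]
  | succ n ih =>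
    rw [cubeE_succ]
    simp only [Fin.sum_univ_succ, Fin.cons_zero, Fin.cons_succ, ← add_assoc]
    rw [ih, ih, one_smul, neg_one_smul, ← sub_eq_add_neg]
    have := parallelogram_law_with_norm ℝ w (v 0)
    linarith

/-- Khintchine's inequality with the sharp constant (Szarek, Latala-Oleszkiewicz). -/
theorem khintchine {H : Type*} [NormedAddCommGroup H] [InnerProductSpace ℝ H] (n : ℕ)
    (v : Fin n → H) :
    Real.sqrt (∑ i, ‖v i‖ ^ 2) ≤ Real.sqrt 2 * cubeE n (fun x => ‖∑ i, x i • v i‖) := by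
  set f : (Fin n → ℝ) → ℝ := fun x => ‖∑ i, x i • v i‖ with hf
  have hsq : cubeE n (fun x => f x ^ 2) = ∑ i, ‖v i‖ ^ 2 := by
    have := cube_norm_sq n 0 v
    simpa [hf] using this
  have hneg : ∀ x, f (-x) = f x := by
    intro x; simp [hf]
  have hN : cubeE n (fun x => f x * f (-x)) = cubeE n (fun x => f x ^ 2) := by
    congr 1; ext x; rw [hneg]; ring
  have h0 : ∀ x, 0 ≤ f x := fun x => norm_nonneg _
  have hflip : ∀ x, (n : ℝ) * f x - 2 * f x ≤ ∑ i, f (cflip i x) := by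
    intro x
    have hi : ∀ i, ∑ k, cflip i x k • v k = ∑ k, x k • v k - (2 : ℝ) • (x i • v i) := by
      intro i
      have : ∀ k, cflip i x k • v k = x k • v k - if k = i then (2 : ℝ) • (x i • v i) else 0 := by
        intro k
        by_cases h : k = i
        · subst h; simp [cflip]; module
        · simp [cflip, h]
      simp [this, Finset.sum_sub_distrib]
    have hs : ∑ i, ∑ k, cflip i x k • v k = ((n : ℝ) - 2) • ∑ k, x k • v k := by
      simp only [hi, Finset.sum_sub_distrib, ← Finset.smul_sum, Finset.sum_const, Finset.card_univ,
        Fintype.card_fin, sub_smul, Nat.cast_smul_eq_nsmul]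
    have h1 : ‖∑ i, ∑ k, cflip i x k • v k‖ ≤ ∑ i, f (cflip i x) := norm_sum_le _ _
    rw [hs, norm_smul, Real.norm_eq_abs] at h1
    have h2 : ((n : ℝ) - 2) * f x ≤ |(n : ℝ) - 2| * f x :=
      mul_le_mul_of_nonneg_right (le_abs_self _) (h0 x)
    have h3 : |(n : ℝ) - 2| * f x ≤ ∑ i, f (cflip i x) := h1
    linarith
  have hQ : cQ n f ≤ 2 * cubeE n (fun x => f x ^ 2) := by
    unfold cQ
    rw [← map_sum, ← smul_eq_mul, ← map_smul]
    refine cubeE_mono _ _ _ (fun x _ => ?_)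
    simp only [Finset.sum_apply, Pi.smul_apply, smul_eq_mul, Finset.sum_sub_distrib,
      ← Finset.mul_sum, Finset.sum_const, Finset.card_univ, Fintype.card_fin, nsmul_eq_mul]
    nlinarith [hflip x, h0 x]
  have hB := cube_B n f
  have hE : 0 ≤ cubeE n f := by
    rw [← cubeE_const n 0]; exact cubeE_mono _ _ _ (fun x _ => h0 x)
  rw [← hsq]
  refine Real.sqrt_le_iff.mpr ⟨by positivity, ?_⟩
  rw [mul_pow, Real.sq_sqrt (by norm_num)]
  linarith

theorem mixed_aux (N k : ℕ) (M : ℝ)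
    (F : Fin N → MultilinearMap ℝ (fun _ : Fin k => (Fin N → ℝ)) ℝ)
    (hF : ∀ x : Fin k → Fin N → ℝ, (∀ i j, |x i j| ≤ 1) → ∑ a, |F a x| ≤ M) :
    ∑ a, Real.sqrt (∑ j : Fin k → Fin N, (F a (fun i => Pi.single (j i) 1)) ^ 2)
      ≤ Real.sqrt 2 ^ k * M := by
  induction k with
  | zero =>
    have := hF (fun i => i.elim0) (fun i => i.elim0)
    simp only [pow_zero, one_mul, Fintype.sum_unique, Real.sqrt_sq_eq_abs]
    convert this using 4
  | succ k ih =>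
    have key : ∀ a, Real.sqrt (∑ j : Fin (k + 1) → Fin N, (F a (fun i => Pi.single (j i) 1)) ^ 2)
        ≤ Real.sqrt 2 * cubeE N (fun y => Real.sqrt (∑ j : Fin k → Fin N,
          ((F a).curryLeft y (fun i => Pi.single (j i) 1)) ^ 2)) := by
      intro a
      have h := khintchine N (fun b : Fin N => (WithLp.toLp 2 (fun j : Fin k → Fin N =>
        (F a).curryLeft (Pi.single b 1) (fun i => Pi.single (j i) 1)) :
          EuclideanSpace ℝ (Fin k → Fin N)))
      convert h using 2
      · rw [← (Fin.consEquiv (fun _ : Fin (k + 1) => Fin N)).sum_comp, Fintype.sum_prod_type]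
        refine Finset.sum_congr rfl (fun b _ => ?_)
        rw [EuclideanSpace.norm_sq_eq]
        refine Finset.sum_congr rfl (fun j _ => ?_)
        simp only [Real.norm_eq_abs, sq_abs, MultilinearMap.curryLeft_apply]
        congr 2
        ext i
        refine Fin.cases ?_ (fun i => ?_) i <;> simp [Fin.consEquiv]
      · congr 1
        ext y
        rw [EuclideanSpace.norm_eq]
        congr 1
        refine Finset.sum_congr rfl (fun j _ => ?_)
        rw [Real.norm_eq_abs, sq_abs]
        congr 1
        have hy : y = ∑ b, y b • (Pi.single b (1 : ℝ) : Fin N → ℝ) := pi_eq_sum_univ' y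
        conv_lhs => rw [hy, map_sum]
        simp
    calc _ ≤ ∑ a, Real.sqrt 2 * cubeE N (fun y => Real.sqrt (∑ j : Fin k → Fin N,
          ((F a).curryLeft y (fun i => Pi.single (j i) 1)) ^ 2)) :=
            Finset.sum_le_sum (fun a _ => key a)
      _ = Real.sqrt 2 * cubeE N (fun y => ∑ a, Real.sqrt (∑ j : Fin k → Fin N,
          ((F a).curryLeft y (fun i => Pi.single (j i) 1)) ^ 2)) := by
            rw [← Finset.mul_sum, ← map_sum]; congr 2; ext y; simp
      _ ≤ Real.sqrt 2 * cubeE N (fun _ => Real.sqrt 2 ^ k * M) := by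
            refine mul_le_mul_of_nonneg_left (cubeE_mono _ _ _ (fun y hy => ?_)) (Real.sqrt_nonneg _)
            refine ih (fun a => (F a).curryLeft y) (fun x hx => ?_)
            refine hF (Fin.cons y x) (fun i => ?_)
            refine Fin.cases ?_ (fun i => ?_) i
            · simpa using hy
            · simpa using hx i
      _ = _ := by rw [cubeE_const]; ring


/-- **Mixed (ℓ₁,ℓ₂)-Littlewood inequality.** For every integer `m ≥ 2` (here written as
`m + 2` with `m : ℕ`), every positive integer `N`, and every continuous `m`-linear form
`U` on `(ℝ^N)^m` (with the sup norm on `ℝ^N`), we have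
`∑_{j₁} (∑_{j₂,...,j_m} |U(e_{j₁},...,e_{j_m})|²)^{1/2} ≤ (√2)^{m-1} ‖U‖`. -/
theorem mixed_l1_l2_littlewood (m N : ℕ) (hN : 0 < N)
    (U : ContinuousMultilinearMap ℝ (fun _ : Fin (m + 2) => (Fin N → ℝ)) ℝ) :
    ∑ j₁ : Fin N, Real.sqrt (∑ j : Fin (m + 1) → Fin N,
        |U (Fin.cons (Pi.single j₁ 1) (fun i => Pi.single (j i) 1))| ^ 2)
      ≤ Real.sqrt 2 ^ (m + 1) * ‖U‖ := by
  have h := mixed_aux N (m + 1) ‖U‖ (fun a => U.toMultilinearMap.curryLeft (Pi.single a 1)) (by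
    intro x hx
    set s : Fin N → ℝ := fun a => SignType.sign (U (Fin.cons (Pi.single a 1) x)) with hs
    have h1 : ∑ a, |U.toMultilinearMap.curryLeft (Pi.single a 1) x| = U (Fin.cons s x) := by
      have h2 : U (Fin.cons s x) = U.toMultilinearMap.curryLeft s x := rfl
      have hy : s = ∑ b, s b • (Pi.single b (1 : ℝ) : Fin N → ℝ) := pi_eq_sum_univ' s
      rw [h2]
      conv_rhs => rw [hy, map_sum]
      simp [hs, sign_mul_self]
    rw [h1]
    refine (le_abs_self _).trans ((U.le_opNorm _).trans ?_)
    refine mul_le_of_le_one_right (norm_nonneg _) (Finset.prod_le_one (fun _ _ => norm_nonneg _) ?_)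
    intro i _
    refine (pi_norm_le_iff_of_nonneg zero_le_one).mpr (fun b => ?_)
    rw [Real.norm_eq_abs]
    revert b
    refine Fin.cases ?_ (fun i => ?_) i
    · intro b
      simp only [Fin.cons_zero, hs]
      rcases SignType.sign (U (Fin.cons (Pi.single b 1) x)) <;> simp
    · intro b
      simpa using hx i b)
  simpa [sq_abs] using h
end

section
/- Let T₂ : ℝ² × ℝ² → ℝ be the bilinear form T₂(x,y) = x₁y₁ + x₁y₂ + x₂y₁ − x₂y₂, where ℝ² carries the sup norm. Then the operator norm of T₂ equals 2. -/
/-- The bilinear form `T₂(x,y) = x₁y₁ + x₁y₂ + x₂y₁ − x₂y₂` on `ℝ² × ℝ²`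
(with the sup norm on `ℝ²`) has operator norm `2`. -/
theorem norm_T2 (T₂ : (Fin 2 → ℝ) →L[ℝ] (Fin 2 → ℝ) →L[ℝ] ℝ)
    (hT : ∀ x y : Fin 2 → ℝ,
      T₂ x y = x 0 * y 0 + x 0 * y 1 + x 1 * y 0 - x 1 * y 1) :
    ‖T₂‖ = 2 := by
  apply le_antisymm
  · refine T₂.opNorm_le_bound₂ (by norm_num) fun x y => ?_
    have hx0 : |x 0| ≤ ‖x‖ := norm_le_pi_norm x 0
    have hx1 : |x 1| ≤ ‖x‖ := norm_le_pi_norm x 1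
    have hy0 : |y 0| ≤ ‖y‖ := norm_le_pi_norm y 0
    have hy1 : |y 1| ≤ ‖y‖ := norm_le_pi_norm y 1
    have hy : |y 0 + y 1| + |y 0 - y 1| ≤ 2 * ‖y‖ := by
      rw [abs_le] at hy0 hy1
      rcases abs_cases (y 0 + y 1) with h | h <;> rcases abs_cases (y 0 - y 1) with h' | h' <;>
        linarith [hy0.1, hy0.2, hy1.1, hy1.2]
    rw [hT, Real.norm_eq_abs]
    calc |x 0 * y 0 + x 0 * y 1 + x 1 * y 0 - x 1 * y 1|
        = |x 0 * (y 0 + y 1) + x 1 * (y 0 - y 1)| := by congr 1; ring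
      _ ≤ |x 0| * |y 0 + y 1| + |x 1| * |y 0 - y 1| := by
          rw [← abs_mul, ← abs_mul]; exact abs_add_le _ _
      _ ≤ ‖x‖ * |y 0 + y 1| + ‖x‖ * |y 0 - y 1| := by gcongr
      _ = ‖x‖ * (|y 0 + y 1| + |y 0 - y 1|) := by ring
      _ ≤ ‖x‖ * (2 * ‖y‖) := by gcongr
      _ = 2 * ‖x‖ * ‖y‖ := by ring
  · have h := T₂.le_opNorm₂ (fun _ => 1) (fun _ => 1)
    rw [hT] at h
    have h1 : ‖(fun _ => 1 : Fin 2 → ℝ)‖ = 1 := by rw [pi_norm_const]; norm_num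
    rw [h1] at h
    norm_num at h
    exact h
end

section
/- Let m ≥ 2 be an integer and q = (q₁,...,q_m) ∈ [1,2]^m satisfy 1/q₁ + ··· + 1/q_m = (m+1)/2. Then for every positive integer N and every continuous m-linear form T : (ℝ^N)^m → ℝ (ℝ^N with the sup norm), ( Σ_{j₁=1}^{N} ( Σ_{j₂=1}^{N} ( ··· ( Σ_{j_m=1}^{N} |T(e_{j₁},...,e_{j_m})|^{q_m} )^{q_{m-1}/q_m} ··· )^{q₂/q₃} )^{q₁/q₂} )^{1/q₁} ≤ (√2)^{m-1} · ‖T‖. -/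
open Real

/-- The mixed `ℓ_{q₁}(ℓ_{q₂}(···ℓ_{q_m}))`-norm of an array `f` indexed by
`(Fin m → Fin N)`:
`(∑_{j₁} (∑_{j₂} (··· (∑_{j_m} |f(j₁,...,j_m)|^{q_m})^{q_{m-1}/q_m} ···)^{q₂/q₃})^{q₁/q₂})^{1/q₁}`. -/
noncomputable def mixedNorm {N : ℕ} : (m : ℕ) → (Fin m → ℝ) → ((Fin m → Fin N) → ℝ) → ℝ
  | 0, _, f => |f (fun i => i.elim0)|
  | m + 1, q, f =>
      (∑ j : Fin N,
        (mixedNorm m (fun i => q i.succ) (fun r => f (Fin.cons j r))) ^ (q 0))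
        ^ (1 / q 0)

namespace BHproof

/-- sign of a boolean -/
noncomputable def sg (b : Bool) : ℝ := if b then 1 else -1

/-- flip the i-th coordinate -/
def flp {n : ℕ} (i : Fin n) (e : Fin n → Bool) : Fin n → Bool := Function.update e i (!(e i))

/-- flip all coordinates -/
def ngt {n : ℕ} (e : Fin n → Bool) : Fin n → Bool := fun i => !(e i)

/-- Dirichlet energy -/
noncomputable def En {n : ℕ} (h : (Fin n → Bool) → ℝ) : ℝ := ∑ e, ∑ i, (h e - h (flp i e)) ^ 2

lemma sum_cons {n : ℕ} (F : (Fin (n + 1) → Bool) → ℝ) :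
    ∑ e, F e = ∑ e : Fin n → Bool, (F (Fin.cons true e) + F (Fin.cons false e)) := by
  rw [← (Fin.consEquiv (fun _ : Fin (n + 1) => Bool)).sum_comp, Fintype.sum_prod_type,
    Fintype.sum_bool, ← Finset.sum_add_distrib]
  rfl

lemma flp_zero {n : ℕ} (b : Bool) (e : Fin n → Bool) :
    flp 0 (Fin.cons b e : Fin (n + 1) → Bool) = Fin.cons (!b) e := by
  simp [flp]

lemma flp_succ {n : ℕ} (b : Bool) (e : Fin n → Bool) (i : Fin n) :
    flp i.succ (Fin.cons b e : Fin (n + 1) → Bool) = Fin.cons b (flp i e) := by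
  simp [flp, Fin.cons_update]

lemma ngt_cons {n : ℕ} (b : Bool) (e : Fin n → Bool) :
    ngt (Fin.cons b e : Fin (n + 1) → Bool) = Fin.cons (!b) (ngt e) := by
  funext i
  refine Fin.cases ?_ (fun i => ?_) i <;> simp [ngt]

lemma En_succ {n : ℕ} (h : (Fin (n + 1) → Bool) → ℝ) :
    En h = (1 / 2) * (En (fun e => h (Fin.cons true e) + h (Fin.cons false e))
        + En (fun e => h (Fin.cons true e) - h (Fin.cons false e)))
      + 2 * ∑ e : Fin n → Bool, (h (Fin.cons true e) - h (Fin.cons false e)) ^ 2 := by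
  unfold En
  rw [sum_cons]
  rw [← Finset.sum_add_distrib, Finset.mul_sum, Finset.mul_sum, ← Finset.sum_add_distrib]
  refine Finset.sum_congr rfl fun e _ => ?_
  rw [Fin.sum_univ_succ, Fin.sum_univ_succ]
  simp only [flp_zero, flp_succ, Bool.not_true, Bool.not_false]
  have : ∑ i, (h (Fin.cons true e) - h (Fin.cons true (flp i e))) ^ 2
      + ∑ i, (h (Fin.cons false e) - h (Fin.cons false (flp i e))) ^ 2
      = (1 / 2) * (∑ i, (h (Fin.cons true e) + h (Fin.cons false e)
          - (h (Fin.cons true (flp i e)) + h (Fin.cons false (flp i e)))) ^ 2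
        + ∑ i, (h (Fin.cons true e) - h (Fin.cons false e)
          - (h (Fin.cons true (flp i e)) - h (Fin.cons false (flp i e)))) ^ 2) := by
    rw [← Finset.sum_add_distrib, ← Finset.sum_add_distrib, Finset.mul_sum]
    exact Finset.sum_congr rfl fun i _ => by ring
  linarith

lemma poincare (n : ℕ) :
    (∀ h : (Fin n → Bool) → ℝ, (∀ e, h (ngt e) = h e) →
      8 * ∑ e, h e ^ 2 ≤ En h + 8 * (∑ e, h e) ^ 2 / 2 ^ n) ∧
    (∀ h : (Fin n → Bool) → ℝ, (∀ e, h (ngt e) = - h e) →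
      4 * ∑ e, h e ^ 2 ≤ En h) := by
  induction n with
  | zero =>
    refine ⟨fun h _ => ?_, fun h hh => ?_⟩
    · simp [En]
    · have h0 : h default = 0 := by
        have := hh default
        rw [Subsingleton.elim (ngt default) default] at this
        linarith
      have h1 : ∀ e, h e = 0 := fun e => by rw [Subsingleton.elim e default, h0]
      simp [En, h1]
  | succ n ih =>
    obtain ⟨ihe, iho⟩ := ih
    have key : ∀ h : (Fin (n + 1) → Bool) → ℝ, ∑ e, h e ^ 2 = (1 / 2) *
        (∑ e : Fin n → Bool, (h (Fin.cons true e) + h (Fin.cons false e)) ^ 2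
        + ∑ e : Fin n → Bool, (h (Fin.cons true e) - h (Fin.cons false e)) ^ 2) := by
      intro h
      rw [sum_cons, ← Finset.sum_add_distrib, Finset.mul_sum]
      exact Finset.sum_congr rfl fun i _ => by ring
    refine ⟨fun h hh => ?_, fun h hh => ?_⟩
    · have h1 := ihe (fun e => h (Fin.cons true e) + h (Fin.cons false e)) (fun e => by
        have a := hh (Fin.cons true e)
        have b := hh (Fin.cons false e)
        rw [ngt_cons] at a b
        simp only [Bool.not_true, Bool.not_false] at a b
        simp only [a, b]; ring)
      have h2 := iho (fun e => h (Fin.cons true e) - h (Fin.cons false e)) (fun e => by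
        have a := hh (Fin.cons true e)
        have b := hh (Fin.cons false e)
        rw [ngt_cons] at a b
        simp only [Bool.not_true, Bool.not_false] at a b
        simp only [a, b]; ring)
      rw [key, En_succ, sum_cons]
      have h3 : ∀ x : ℝ, 8 * x / 2 ^ (n + 1) = (1 / 2) * (8 * x / 2 ^ n) := by
        intro x; rw [pow_succ]; field_simp
      rw [h3]
      linarith
    · have h1 := iho (fun e => h (Fin.cons true e) + h (Fin.cons false e)) (fun e => by
        have a := hh (Fin.cons true e)
        have b := hh (Fin.cons false e)
        rw [ngt_cons] at a b
        simp only [Bool.not_true, Bool.not_false] at a b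
        simp only [a, b]; ring)
      rw [key, En_succ]
      have h2 : 0 ≤ En (fun e : Fin n → Bool => h (Fin.cons true e) - h (Fin.cons false e)) :=
        Finset.sum_nonneg fun _ _ => Finset.sum_nonneg fun _ _ => sq_nonneg _
      linarith

lemma sum_sq (n : ℕ) (a : Fin n → ℝ) :
    ∑ e : Fin n → Bool, (∑ j, sg (e j) * a j) ^ 2 = 2 ^ n * ∑ j, a j ^ 2 := by
  induction n with
  | zero => simp
  | succ n ih =>
    rw [sum_cons]
    simp only [Fin.sum_univ_succ, Fin.cons_zero, Fin.cons_succ]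
    have := ih (fun j => a j.succ)
    have h2 : ∀ y : ℝ, (sg true * a 0 + y) ^ 2 + (sg false * a 0 + y) ^ 2
        = 2 * a 0 ^ 2 + 2 * y ^ 2 := by
      intro y; simp [sg]; ring
    simp only [h2]
    rw [Finset.sum_add_distrib, ← Finset.mul_sum Finset.univ (fun e : Fin n → Bool => (∑ j, sg (e j) * a j.succ) ^ 2), this]
    simp
    ring

lemma flp_flp {n : ℕ} (i : Fin n) (e : Fin n → Bool) : flp i (flp i e) = e := by
  simp [flp]

lemma sum_flp {n : ℕ} (i : Fin n) (F : (Fin n → Bool) → ℝ) :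
    ∑ e, F (flp i e) = ∑ e, F e :=
  Equiv.sum_comp (Function.Involutive.toPerm (flp i) (flp_flp i)) F

lemma sg_not (b : Bool) : sg (!b) = - sg b := by cases b <;> simp [sg]

lemma g_flp {n : ℕ} (a : Fin n → ℝ) (i : Fin n) (e : Fin n → Bool) :
    ∑ j, sg (flp i e j) * a j = ∑ j, sg (e j) * a j - 2 * (sg (e i) * a i) := by
  rw [eq_sub_iff_add_eq]
  rw [← Finset.add_sum_erase _ _ (Finset.mem_univ i),
    ← Finset.add_sum_erase _ (fun j => sg (e j) * a j) (Finset.mem_univ i)]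
  have : ∑ j ∈ Finset.univ.erase i, sg (flp i e j) * a j
      = ∑ j ∈ Finset.univ.erase i, sg (e j) * a j := by
    refine Finset.sum_congr rfl fun j hj => ?_
    rw [flp, Function.update_of_ne (Finset.ne_of_mem_erase hj)]
  rw [this]
  simp only [flp, Function.update_self, sg_not]
  ring

/-- Sharp real Khinchine inequality in L1 (Szarek), after Latala and Oleszkiewicz. -/
lemma khinchine (n : ℕ) (a : Fin n → ℝ) :
    √(∑ j, a j ^ 2) ≤ √2 * ((2 ^ n)⁻¹ * ∑ e : Fin n → Bool, |∑ j, sg (e j) * a j|) := by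
  set g : (Fin n → Bool) → ℝ := fun e => ∑ j, sg (e j) * a j with hg
  set h : (Fin n → Bool) → ℝ := fun e => |g e| with hh
  have hP := (poincare n).1 h (fun e => by
    simp only [hh, hg, ngt, sg_not, neg_mul, Finset.sum_neg_distrib, abs_neg])
  have hS : ∑ e, h e ^ 2 = 2 ^ n * ∑ j, a j ^ 2 := by
    rw [← sum_sq]; simp [hh, hg]
  have hE : En h ≤ 4 * ∑ e, h e ^ 2 := by
    have h1 : En h = 2 * n * ∑ e, h e ^ 2 - 2 * ∑ e, h e * ∑ i, h (flp i e) := by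
      have : ∀ e i, (h e - h (flp i e)) ^ 2
          = h e ^ 2 + h (flp i e) ^ 2 - 2 * (h e * h (flp i e)) := fun e i => by ring
      unfold En
      simp only [this, Finset.sum_sub_distrib, Finset.sum_add_distrib, ← Finset.mul_sum]
      have h3 : ∑ e, ∑ i, h (flp i e) ^ 2 = n * ∑ e, h e ^ 2 := by
        rw [Finset.sum_comm]
        simp only [sum_flp _ (fun e => h e ^ 2)]
        simp
      rw [h3]
      simp [← Finset.mul_sum]
      ring
    have h2 : ∀ e, ((n : ℝ) - 2) * h e ^ 2 ≤ h e * ∑ i, h (flp i e) := by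
      intro e
      have h3 : ((n : ℝ) - 2) * h e ≤ ∑ i, h (flp i e) := by
        have h4 : |∑ i, g (flp i e)| ≤ ∑ i, h (flp i e) := Finset.abs_sum_le_sum_abs _ _
        have h5 : ∑ i, g (flp i e) = ((n : ℝ) - 2) * g e := by
          simp only [hg, g_flp, Finset.sum_sub_distrib, ← Finset.mul_sum]
          simp
          ring
        rw [h5, abs_mul] at h4
        refine le_trans ?_ h4
        exact mul_le_mul_of_nonneg_right (le_abs_self _) (abs_nonneg _)
      have := mul_le_mul_of_nonneg_left h3 (abs_nonneg (g e) : 0 ≤ h e)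
      linarith [this]
    have h6 := Finset.sum_le_sum (s := Finset.univ) fun e _ => h2 e
    rw [← Finset.mul_sum] at h6
    rw [h1]
    linarith
  have hM : 0 ≤ (2 ^ n : ℝ)⁻¹ * ∑ e, h e := mul_nonneg (by positivity)
    (Finset.sum_nonneg fun _ _ => abs_nonneg _)
  have hfin : ∑ j, a j ^ 2 ≤ 2 * ((2 ^ n)⁻¹ * ∑ e, h e) ^ 2 := by
    have h7 : ∑ e, h e ^ 2 ≤ 2 * (∑ e, h e) ^ 2 / 2 ^ n := by
      have : 8 * (∑ e, h e) ^ 2 / 2 ^ n = 4 * (2 * (∑ e, h e) ^ 2 / 2 ^ n) := by ring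
      linarith
    rw [hS, le_div_iff₀ (by positivity)] at h7
    have h8 : 2 * ((2 ^ n : ℝ)⁻¹ * ∑ e, h e) ^ 2 = (2 * (∑ e, h e) ^ 2) / (2 ^ n * 2 ^ n) := by
      field_simp
    rw [h8, le_div_iff₀ (by positivity)]
    linarith
  calc √(∑ j, a j ^ 2) ≤ √(2 * ((2 ^ n)⁻¹ * ∑ e, h e) ^ 2) := Real.sqrt_le_sqrt hfin
    _ = _ := by rw [Real.sqrt_mul (by norm_num), Real.sqrt_sq hM]

lemma holder {ι κ : Type*} [Fintype ι] [Fintype κ] (w : κ → ℝ) (g : κ → ι → ℝ)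
    (hw : ∀ k, 0 ≤ w k) (hw1 : ∑ k, w k = 1) (hg : ∀ k j, 0 ≤ g k j) :
    ∑ j, ∏ k, g k j ^ w k ≤ ∏ k, (∑ j, g k j) ^ w k := by
  have hG : ∀ k, 0 ≤ ∑ j, g k j := fun k => Finset.sum_nonneg fun j _ => hg k j
  have h1 : ∀ j, ∏ k, g k j ^ w k
      ≤ (∏ k, (∑ j, g k j) ^ w k) * ∑ k, w k * (g k j / ∑ j, g k j) := by
    intro j
    have h2 : ∏ k, g k j ^ w k
        = (∏ k, (∑ j, g k j) ^ w k) * ∏ k, (g k j / ∑ j, g k j) ^ w k := by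
      rw [← Finset.prod_mul_distrib]
      refine Finset.prod_congr rfl fun k _ => ?_
      rw [← Real.mul_rpow (hG k) (div_nonneg (hg k j) (hG k))]
      congr 1
      by_cases h0 : ∑ j, g k j = 0
      · have := (Finset.sum_eq_zero_iff_of_nonneg fun j _ => hg k j).1 h0 j (Finset.mem_univ j)
        rw [h0, this]; simp
      · field_simp
    rw [h2]
    refine mul_le_mul_of_nonneg_left ?_
      (Finset.prod_nonneg fun k _ => Real.rpow_nonneg (hG k) _)
    exact Real.geom_mean_le_arith_mean_weighted _ _ _ (fun k _ => hw k) hw1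
      (fun k _ => div_nonneg (hg k j) (hG k))
  refine (Finset.sum_le_sum fun j _ => h1 j).trans ?_
  rw [← Finset.mul_sum]
  refine mul_le_of_le_one_right
      (Finset.prod_nonneg fun k _ => Real.rpow_nonneg (hG k) _) ?_
  rw [Finset.sum_comm, ← hw1]
  refine Finset.sum_le_sum fun k _ => ?_
  rw [← Finset.mul_sum, ← Finset.sum_div]
  exact mul_le_of_le_one_right (hw k) (div_self_le_one _)

lemma mink {ι : Type*} [Fintype ι] {n : ℕ} (y : ι → Fin n → ℝ) :
    √(∑ j, (∑ i, y i j) ^ 2) ≤ ∑ i, √(∑ j, y i j ^ 2) := by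
  have h := norm_sum_le Finset.univ (fun i => (WithLp.toLp 2 (y i) : EuclideanSpace ℝ (Fin n)))
  simpa [EuclideanSpace.norm_eq] using h

lemma mN_nonneg {N : ℕ} (m : ℕ) (q : Fin m → ℝ) (f : (Fin m → Fin N) → ℝ) :
    0 ≤ mixedNorm m q f := by
  induction m with
  | zero => exact abs_nonneg _
  | succ m ih =>
    exact Real.rpow_nonneg (Finset.sum_nonneg fun j _ => Real.rpow_nonneg (ih _ _) _) _

lemma mN_one {N : ℕ} (m : ℕ) (q : Fin (m + 1) → ℝ) (hq : q 0 = 1) (f : (Fin (m + 1) → Fin N) → ℝ) :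
    mixedNorm (m + 1) q f
      = ∑ j, mixedNorm m (fun i => q i.succ) (fun r => f (Fin.cons j r)) := by
  rw [mixedNorm, hq]; simp

lemma mN_two {N : ℕ} (m : ℕ) (q : Fin (m + 1) → ℝ) (hq : q 0 = 2) (f : (Fin (m + 1) → Fin N) → ℝ) :
    mixedNorm (m + 1) q f
      = √(∑ j, mixedNorm m (fun i => q i.succ) (fun r => f (Fin.cons j r)) ^ 2) := by
  rw [mixedNorm, hq, Real.sqrt_eq_rpow]; simp

lemma mN_khin {N : ℕ} (m : ℕ) (q : Fin m → ℝ) (hq : ∀ i, q i = 1 ∨ q i = 2)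
    (x : Fin N → (Fin m → Fin N) → ℝ) :
    √(∑ j, mixedNorm m q (x j) ^ 2) ≤ √2 * ((2 ^ N)⁻¹ *
      ∑ e : Fin N → Bool, mixedNorm m q (fun r => ∑ j, sg (e j) * x j r)) := by
  induction m with
  | zero =>
    have := khinchine N (fun j => x j (fun i => i.elim0))
    simpa [mixedNorm] using this
  | succ m ih =>
    have IH := fun i : Fin N => ih (fun i => q i.succ) (fun i => hq _)
      (fun j r => x j (Fin.cons i r))
    rcases hq 0 with h0 | h0
    · simp only [mN_one m q h0]
      refine (mink _).trans ((Finset.sum_le_sum fun i _ => IH i).trans_eq ?_)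
      rw [← Finset.mul_sum, ← Finset.mul_sum, Finset.sum_comm]
    · simp only [mN_two m q h0]
      have hs : ∀ F : Fin N → ℝ, √(∑ j, F j ^ 2) ^ 2 = ∑ j, F j ^ 2 := fun F =>
        Real.sq_sqrt (Finset.sum_nonneg fun _ _ => sq_nonneg _)
      simp only [hs]
      rw [Finset.sum_comm]
      set M : (Fin N → Bool) → Fin N → ℝ := fun e i => mixedNorm m (fun i => q i.succ)
        (fun r => ∑ j, sg (e j) * x j (Fin.cons i r)) with hM
      have h1 : ∀ i, ∑ j, mixedNorm m (fun i => q i.succ) (fun r => x j (Fin.cons i r)) ^ 2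
          ≤ (√2 * (2 ^ N)⁻¹) ^ 2 * (∑ e, M e i) ^ 2 := by
        intro i
        rw [← mul_pow, mul_assoc, ← hs]
        exact pow_le_pow_left₀ (Real.sqrt_nonneg _) (IH i) 2
      refine (Real.sqrt_le_sqrt (Finset.sum_le_sum fun i _ => h1 i)).trans ?_
      rw [← Finset.mul_sum, Real.sqrt_mul (sq_nonneg _), Real.sqrt_sq (by positivity), mul_assoc]
      gcongr
      exact mink M

/-- All sign sums (in fact all evaluations on the unit ball) of the array are bounded by `C`. -/
def Bd {N : ℕ} : (m : ℕ) → ((Fin m → Fin N) → ℝ) → ℝ → Prop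
  | 0, a, C => |a (fun i => i.elim0)| ≤ C
  | m + 1, a, C => ∀ s : Fin N → ℝ, (∀ j, |s j| ≤ 1) →
      Bd m (fun r => ∑ j, s j * a (Fin.cons j r)) C

lemma abs_sg (b : Bool) : |sg b| ≤ 1 := by cases b <;> simp [sg]

lemma avg_le {n : ℕ} (F : (Fin n → Bool) → ℝ) (C : ℝ) (h : ∀ e, F e ≤ C) :
    (2 ^ n : ℝ)⁻¹ * ∑ e, F e ≤ C := by
  rw [inv_mul_le_iff₀ (by positivity)]
  refine (Finset.sum_le_sum fun e _ => h e).trans ?_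
  simp

lemma mN_first {N : ℕ} (m : ℕ) (q : Fin (m + 1) → ℝ) (h0 : q 0 = 1) (h2 : ∀ i, i ≠ 0 → q i = 2)
    (a : (Fin (m + 1) → Fin N) → ℝ) (C : ℝ) (ha : Bd (m + 1) a C) :
    mixedNorm (m + 1) q a ≤ √2 ^ m * C := by
  induction m with
  | zero =>
    rw [mN_one _ _ h0]
    have := ha (fun j => SignType.sign (a (Fin.cons j (fun i => i.elim0)))) (fun j => by
      rcases SignType.trichotomy (SignType.sign (a (Fin.cons j (fun i => i.elim0)))) with h | h | h
        <;> simp [h])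
    simp only [Bd] at this
    simp only [sign_mul_self] at this
    simpa [mixedNorm] using (le_abs_self _).trans this
  | succ m ih =>
    have hq1 : q 1 = 2 := h2 1 (by simp)
    rw [mN_one _ _ h0]
    simp only [mN_two m (fun i => q i.succ) hq1]
    refine (Finset.sum_le_sum fun i _ => mN_khin m _ (fun k => Or.inr (h2 _ (by simp [Fin.ext_iff])))
      (fun j r => a (Fin.cons i (Fin.cons j r)))).trans ?_
    rw [← Finset.mul_sum, ← Finset.mul_sum, Finset.sum_comm, pow_succ', mul_assoc]
    refine mul_le_mul_of_nonneg_left ?_ (Real.sqrt_nonneg _)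
    refine avg_le _ _ fun e => ?_
    have h3 := ih (fun i => Fin.cases 1 (fun _ => 2) i) rfl
      (fun i => Fin.cases (by simp) (by simp) i)
      (fun r => ∑ j, sg (e j) * a (Fin.cons (r 0) (Fin.cons j (Fin.tail r)))) ?_
    · rw [mN_one _ _ rfl] at h3
      have h4 : (fun i : Fin m => q i.succ.succ) = fun _ => 2 := by
        funext i; exact h2 _ (by simp [Fin.ext_iff])
      rw [h4]
      simpa using h3
    · intro s hs
      have h5 := ha s hs (fun j => sg (e j)) (fun j => abs_sg _)
      convert h5 using 2 with r
      simp only [Fin.cons_zero, Fin.tail_cons, Finset.mul_sum]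
      rw [Finset.sum_comm]
      exact Finset.sum_congr rfl fun _ _ => Finset.sum_congr rfl fun _ _ => by ring

lemma mN_all {N : ℕ} (m : ℕ) (q : Fin (m + 1) → ℝ) (k : Fin (m + 1)) (h0 : q k = 1)
    (h2 : ∀ i, i ≠ k → q i = 2)
    (a : (Fin (m + 1) → Fin N) → ℝ) (C : ℝ) (ha : Bd (m + 1) a C) :
    mixedNorm (m + 1) q a ≤ √2 ^ m * C := by
  induction m with
  | zero =>
    obtain rfl : k = 0 := Fin.fin_one_eq_zero k
    exact mN_first _ q h0 h2 a C ha
  | succ m ih =>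
    rcases Fin.eq_zero_or_eq_succ k with rfl | ⟨k, rfl⟩
    · exact mN_first _ q h0 h2 a C ha
    · rw [mN_two _ _ (h2 0 (Fin.succ_ne_zero k).symm)]
      refine (mN_khin _ _ (fun i => ?_) _).trans ?_
      · by_cases h : i = k
        · left; rw [h, h0]
        · right; exact h2 _ (by simpa using h)
      rw [pow_succ', mul_assoc]
      refine mul_le_mul_of_nonneg_left ?_ (Real.sqrt_nonneg _)
      refine avg_le _ _ fun e => ?_
      exact ih _ k h0 (fun i hi => h2 _ (by simpa using hi)) _ (ha _ fun j => abs_sg _)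

lemma Bd_T {N : ℕ} (m : ℕ) (T : ContinuousMultilinearMap ℝ (fun _ : Fin m => (Fin N → ℝ)) ℝ)
    (C : ℝ) (hC : ‖T‖ ≤ C) : Bd m (fun j => T (fun i => Pi.single (j i) 1)) C := by
  induction m with
  | zero =>
    refine le_trans ?_ hC
    have := T.le_opNorm (fun i => Pi.single ((fun i : Fin 0 => (i.elim0 : Fin N)) i) 1)
    rw [Finset.univ_eq_empty, Finset.prod_empty, mul_one] at this
    exact this
  | succ m ih =>
    intro s hs
    have h1 : ‖T.curryLeft s‖ ≤ C := by
      refine (T.curryLeft.le_opNorm s).trans ?_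
      rw [ContinuousMultilinearMap.curryLeft_norm]
      refine (mul_le_of_le_one_right (norm_nonneg _) ?_).trans hC
      exact (pi_norm_le_iff_of_nonneg zero_le_one).2 hs
    convert ih _ h1 using 2 with r
    have h2 : s = ∑ j, s j • (Pi.single j 1 : Fin N → ℝ) := by
      conv_lhs => rw [pi_eq_sum_univ' s]
    conv_rhs => rw [h2]
    rw [map_sum, sum_apply]
    refine Finset.sum_congr rfl fun j _ => ?_
    rw [map_smul, smul_apply, smul_eq_mul,
      ContinuousMultilinearMap.curryLeft_apply]
    congr 1
    show T _ = T _
    congr 1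
    funext i
    refine Fin.cases ?_ (fun i => ?_) i <;> simp

lemma interp {N : ℕ} {κ : Type*} [Fintype κ] (θ : κ → ℝ) (hθ : ∀ k, 0 ≤ θ k)
    (hθ1 : ∑ k, θ k = 1) (m : ℕ) (q : Fin m → ℝ) (p : κ → Fin m → ℝ)
    (hq : ∀ i, 0 < q i) (hp : ∀ k i, 0 < p k i)
    (hpq : ∀ i, 1 / q i = ∑ k, θ k / p k i) (f : (Fin m → Fin N) → ℝ) :
    mixedNorm m q f ≤ ∏ k, mixedNorm m (p k) f ^ θ k := by
  induction m with
  | zero =>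
    simp only [mixedNorm]
    rw [← Real.rpow_sum_of_nonneg (abs_nonneg _) (fun k _ => hθ k), hθ1, Real.rpow_one]
  | succ m ih =>
    have IH := fun j => ih (fun i => q i.succ) (fun k i => p k i.succ) (fun i => hq _)
      (fun k i => hp _ _) (fun i => hpq _) (fun r => f (Fin.cons j r))
    simp only [mixedNorm]
    set A : κ → Fin N → ℝ := fun k j => mixedNorm m (fun i => p k i.succ)
      (fun r => f (Fin.cons j r)) with hA
    have hA0 : ∀ k j, 0 ≤ A k j := fun k j => mN_nonneg _ _ _
    have hH := holder (fun k => θ k * q 0 / p k 0) (fun k j => A k j ^ p k 0)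
      (fun k => div_nonneg (mul_nonneg (hθ k) (hq 0).le) (hp k 0).le)
      (by
        have : ∀ k, θ k * q 0 / p k 0 = q 0 * (θ k / p k 0) := fun k => by ring
        simp only [this]
        rw [← Finset.mul_sum, ← hpq, mul_one_div_cancel (hq 0).ne'])
      (fun k j => Real.rpow_nonneg (hA0 k j) _)
    have hS0 : ∀ k, 0 ≤ ∑ j, A k j ^ p k 0 := fun k =>
      Finset.sum_nonneg fun j _ => Real.rpow_nonneg (hA0 k j) _
    have h1 : ∑ j, mixedNorm m (fun i => q i.succ) (fun r => f (Fin.cons j r)) ^ q 0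
        ≤ ∏ k, (∑ j, A k j ^ p k 0) ^ (θ k * q 0 / p k 0) := by
      refine le_trans (Finset.sum_le_sum fun j _ => ?_) hH
      refine (Real.rpow_le_rpow (mN_nonneg _ _ _) (IH j) (hq 0).le).trans_eq ?_
      rw [← Real.finsetProd_rpow _ _ (fun k _ => Real.rpow_nonneg (hA0 k j) _)]
      refine Finset.prod_congr rfl fun k _ => ?_
      rw [← Real.rpow_mul (hA0 k j), ← Real.rpow_mul (hA0 k j)]
      congr 1
      have := (hp k 0).ne'
      field_simp
    refine (Real.rpow_le_rpow (Finset.sum_nonneg fun j _ => Real.rpow_nonneg (mN_nonneg _ _ _) _)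
      h1 (one_div_pos.2 (hq 0)).le).trans_eq ?_
    rw [← Real.finsetProd_rpow _ _ (fun k _ => Real.rpow_nonneg (hS0 k) _)]
    refine Finset.prod_congr rfl fun k _ => ?_
    rw [← Real.rpow_mul (hS0 k), ← Real.rpow_mul (hS0 k)]
    congr 1
    have := (hp k 0).ne'
    have := (hq 0).ne'
    field_simp

end BHproof

/-- **Generalized Bohnenblust–Hille inequality for real scalars with constant `(√2)^{m-1}`.**
Let `m ≥ 2` (written as `m + 2`) and `q = (q₁,...,q_m) ∈ [1,2]^m` with
`1/q₁ + ⋯ + 1/q_m = (m+1)/2`. Then for every positive integer `N` and every continuous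
`m`-linear form `T` on `(ℝ^N)^m` (sup norm), the mixed `ℓ_{q₁}(···ℓ_{q_m})`-norm of the
coefficient array `(T(e_{j₁},...,e_{j_m}))` is at most `(√2)^{m-1}·‖T‖`. -/
theorem generalized_bohnenblust_hille (m : ℕ) (q : Fin (m + 2) → ℝ)
    (hq1 : ∀ i, 1 ≤ q i) (hq2 : ∀ i, q i ≤ 2)
    (hq : ∑ i, 1 / q i = ((m : ℝ) + 3) / 2)
    (N : ℕ) (hN : 0 < N)
    (T : ContinuousMultilinearMap ℝ (fun _ : Fin (m + 2) => (Fin N → ℝ)) ℝ) :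
    mixedNorm (m + 2) q (fun j => T (fun i => Pi.single (j i) 1))
      ≤ Real.sqrt 2 ^ (m + 1) * ‖T‖ := by
  have hq0 : ∀ i, 0 < q i := fun i => zero_lt_one.trans_le (hq1 i)
  set θ : Fin (m + 2) → ℝ := fun k => 2 * (1 / q k) - 1 with hθd
  have hθ : ∀ k, 0 ≤ θ k := fun k => by
    have : 1 / 2 ≤ 1 / q k := one_div_le_one_div_of_le (hq0 k) (hq2 k)
    simp only [hθd]; linarith
  have hθ1 : ∑ k, θ k = 1 := by
    simp only [hθd, Finset.sum_sub_distrib, ← Finset.mul_sum, hq]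
    simp
    ring
  have hI := BHproof.interp θ hθ hθ1 (m + 2) q (fun k i => if i = k then 1 else 2) hq0
    (fun k i => by split_ifs <;> norm_num) (fun i => by
      have h1 : ∀ k, θ k / (if i = k then 1 else 2) = θ k / 2 + (if i = k then θ k / 2 else 0) := by
        intro k; split_ifs <;> ring
      simp only [h1, Finset.sum_add_distrib, ← Finset.sum_div, hθ1]
      simp [hθd]
      ring) (fun j => T (fun i => Pi.single (j i) 1))
  refine hI.trans ?_
  have h2 : ∀ k : Fin (m + 2), mixedNorm (m + 2) (fun i => if i = k then 1 else 2)
      (fun j => T (fun i => Pi.single (j i) 1)) ≤ √2 ^ (m + 1) * ‖T‖ := fun k =>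
    BHproof.mN_all (m + 1) _ k (by simp) (fun i hi => by simp [hi]) _ _
      (BHproof.Bd_T _ T _ le_rfl)
  refine (Finset.prod_le_prod (fun k _ => Real.rpow_nonneg (BHproof.mN_nonneg _ _ _) _)
    (fun k _ => Real.rpow_le_rpow (BHproof.mN_nonneg _ _ _) (h2 k) (hθ k))).trans_eq ?_
  rw [← Real.rpow_sum_of_nonneg (by positivity) (fun k _ => hθ k), hθ1, Real.rpow_one]
end
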